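/- For every ε > 0 there exists a tournament T such that, with unit weights 𝟙 (w(v) = 1 for all v), OPT(T,𝟙) ≥ (7/3 − ε)·SA₁(T,𝟙). Consequently, the worst-case integrality gap sup_{(T,w)} OPT(T,w)/SA₁(T,w) is exactly 7/3. -/

import Mathlib

variable {V : Type*}

/-- A directed triangle: arcs `a → b`, `b → c`, `c → a`. -/
def Triangle (arc : V → V → Prop) (a b c : V) : Prop :=
  arc a b ∧ arc b c ∧ arc c a

/-- A tournament: an irreflexive relation with exactly one arc between any two
distinct vertices. -/
def IsTournament (arc : V → V → Prop) : Prop :=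
  (∀ v, ¬ arc v v) ∧ ∀ a b : V, a ≠ b → (arc a b ↔ ¬ arc b a)

/-- A feedback vertex set: removing `X` leaves no directed triangle. -/
def IsFVS (arc : V → V → Prop) (X : Set V) : Prop :=
  ∀ a b c : V, a ∉ X → b ∉ X → c ∉ X → ¬ Triangle arc a b c

/-- The constraints of the first level of the Sherali–Adams hierarchy applied to
the basic relaxation of the feedback vertex set problem of a tournament:
`x` is the vector of vertex variables, `y` the (symmetric) lift over pairs. -/
def SA1Feasible (arc : V → V → Prop) (x : V → ℝ) (y : V → V → ℝ) : Prop :=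
  (∀ a b, y a b = y b a) ∧
  (∀ a, 0 ≤ x a ∧ x a ≤ 1) ∧
  (∀ a b c, Triangle arc a b c → 1 + y a b + y b c ≤ x a + x b + x c) ∧
  (∀ a b c d, Triangle arc a b c → d ≠ a → d ≠ b → d ≠ c →
    x d ≤ y a d + y b d + y c d ∧
    1 + y a d + y b d + y c d ≤ x a + x b + x c + x d) ∧
  (∀ a b, a ≠ b → y a b ≤ x a ∧ 0 ≤ y a b)

/-- `SA₁(T,w)`: the optimum value of the level-1 Sherali-Adams relaxation. -/
noncomputable def SA1Val [Fintype V] (arc : V → V → Prop) (w : V → ℚ) : ℝ :=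
  sInf {t : ℝ | ∃ x y, SA1Feasible arc x y ∧ t = ∑ v, (w v : ℝ) * x v}

open Finset

theorem IsTournament.asymm {arc : V → V → Prop} (hT : IsTournament arc) {a b : V}
    (h : arc a b) : ¬ arc b a := by
  by_cases hab : a = b
  · subst hab
    exact hT.1 a
  · exact (hT.2 a b hab).1 h

theorem IsTournament.total {arc : V → V → Prop} (hT : IsTournament arc) {a b : V}
    (h : a ≠ b) : arc a b ∨ arc b a := by
  by_cases hba : arc b a
  · exact Or.inr hba
  · exact Or.inl ((hT.2 a b h).2 hba)

theorem Triangle.rotate {arc : V → V → Prop} {a b c : V} (h : Triangle arc a b c) :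
    Triangle arc b c a :=
  ⟨h.2.1, h.2.2, h.1⟩

/-- `a` and `b` are the opposite vertices of two triangles which share an arc `u → v`. -/
def IsDiagonal (arc : V → V → Prop) (a b : V) : Prop :=
  ∃ u v, arc u v ∧ (arc v a ∧ arc a u) ∧ arc v b ∧ arc b u

/-- No triangle has two diagonal sides. -/
def IsLight (arc : V → V → Prop) : Prop :=
  ∀ a b c, Triangle arc a b c → IsDiagonal arc a b → ¬ IsDiagonal arc b c

section Light

variable {arc : V → V → Prop}

theorem IsLight.not_triangle_of_arc (hL : IsLight arc) {u v a b c : V} (huv : arc u v)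
    (ha : arc v a ∧ arc a u) (hb : arc v b ∧ arc b u) (hc : arc v c ∧ arc c u) :
    ¬ Triangle arc a b c := fun h =>
  hL a b c h ⟨u, v, huv, ha, hb⟩ ⟨u, v, huv, hb, hc⟩

/-- If `a`, `b` witness that the in-neighbourhoods of `p`, `q` among the
out-neighbours of `r` are incomparable, then `a → b`. -/
theorem IsLight.arc_of_incomparable (hT : IsTournament arc) (hL : IsLight arc)
    {p q r a b : V} (hpq : arc p q) (hpr : arc p r) (hqr : arc q r) (hra : arc r a)
    (hrb : arc r b) (hap : arc a p) (hpb : arc p b) (hbq : arc b q) (hqa : arc q a) :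
    arc a b := by
  have hab : a ≠ b := by
    rintro rfl
    exact hT.asymm hap hpb
  refine (hT.total hab).resolve_right fun hba => ?_
  exact hL.not_triangle_of_arc hap ⟨hpq, hqa⟩ ⟨hpr, hra⟩ ⟨hpb, hba⟩ ⟨hqr, hrb, hbq⟩

theorem IsLight.false_of_incomparable_path (hT : IsTournament arc) (hL : IsLight arc)
    {r f g h a b c : V} (hf : arc f r) (hg : arc g r) (hh : arc h r) (hfg : arc f g)
    (hgh : arc g h) (ha : arc r a ∧ arc a f ∧ arc g a) (hb : arc r b ∧ arc b g ∧ arc h b)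
    (hc : arc r c ∧ arc c h ∧ arc g c) : False := by
  have hbc : arc b c :=
    hL.arc_of_incomparable hT hgh hg hh hb.1 hc.1 hb.2.1 hc.2.2 hc.2.1 hb.2.2
  exact hL g r b ⟨hg, hb.1, hb.2.1⟩ ⟨a, f, ha.2.1, ⟨hfg, ha.2.2⟩, hf, ha.1⟩
    ⟨c, h, hc.2.1, ⟨hh, hc.1⟩, hb.2.2, hbc⟩

/-- Among three in-neighbours of `r`, two have comparable in-neighbourhoods among the
out-neighbours of `r`. -/
theorem IsLight.false_of_incomparable (hT : IsTournament arc) (hL : IsLight arc)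
    {r : V} {F : Finset V} (hF : ∀ f ∈ F, arc f r) {f g h : V} (hf : f ∈ F) (hg : g ∈ F)
    (hh : h ∈ F) (hfg : ∃ a, arc r a ∧ arc a f ∧ arc g a)
    (hgf : ∃ a, arc r a ∧ arc a g ∧ arc f a) (hgh : ∃ a, arc r a ∧ arc a g ∧ arc h a)
    (hhg : ∃ a, arc r a ∧ arc a h ∧ arc g a) (hfh : ∃ a, arc r a ∧ arc a f ∧ arc h a)
    (hhf : ∃ a, arc r a ∧ arc a h ∧ arc f a) : False := by
  have key : ∀ f ∈ F, ∀ g ∈ F, ∀ h ∈ F, arc f g → arc g h →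
      (∃ a, arc r a ∧ arc a f ∧ arc g a) → (∃ a, arc r a ∧ arc a g ∧ arc h a) →
      (∃ a, arc r a ∧ arc a h ∧ arc g a) → False := by
    rintro f hf g hg h hh h1 h2 ⟨a, ha⟩ ⟨b, hb⟩ ⟨c, hc⟩
    exact hL.false_of_incomparable_path hT (hF f hf) (hF g hg) (hF h hh) h1 h2 ha hb hc
  have ne : ∀ {f g : V}, (∃ a, arc r a ∧ arc a f ∧ arc g a) → f ≠ g := by
    rintro f _ ⟨a, -, h1, h2⟩ rfl
    exact hT.asymm h1 h2
  rcases hT.total (ne hfg) with h1 | h1 <;> rcases hT.total (ne hgh) with h2 | h2 <;>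
    rcases hT.total (ne hfh) with h3 | h3
  · exact key f hf g hg h hh h1 h2 hfg hgh hhg
  · exact key f hf g hg h hh h1 h2 hfg hgh hhg
  · exact key f hf h hh g hg h3 h2 hfh hhg hgh
  · exact key h hh f hf g hg h3 h1 hhf hfg hgf
  · exact key g hg f hf h hh h1 h3 hgf hfh hhf
  · exact key g hg h hh f hf h2 h3 hgh hhf hfh
  · exact key h hh g hg f hf h2 h1 hhg hgf hfg
  · exact key h hh g hg f hf h2 h1 hhg hgf hfg

open Classical in
/-- The in-neighbourhoods in `R` of the vertices of `F` are covered by two of them. -/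
theorem IsLight.exists_cover (hT : IsTournament arc) (hL : IsLight arc) {r : V}
    {F R : Finset V} (hF : ∀ f ∈ F, arc f r) (hR : ∀ a ∈ R, arc r a)
    (hne : ∃ f ∈ F, ∃ a ∈ R, arc a f) :
    ∃ p ∈ F, ∃ q ∈ F, (p = q ∨ arc p q) ∧ (∃ a ∈ R, arc a q) ∧
      ∀ f ∈ F, (∀ a ∈ R, arc a f → arc a p) ∨ ∀ a ∈ R, arc a f → arc a q := by
  set X : V → Finset V := fun f => R.filter (arc · f) with hX
  have sub : ∀ f g, X f ⊆ X g → ∀ a ∈ R, arc a f → arc a g := fun f g h a ha haf =>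
    (mem_filter.1 (h (mem_filter.2 ⟨ha, haf⟩))).2
  have nsub : ∀ f, ∀ g ∈ F, ¬ X f ⊆ X g → ∃ a, arc r a ∧ arc a f ∧ arc g a := by
    intro f g hg h
    obtain ⟨a, haf, hag⟩ := not_subset.1 h
    obtain ⟨haR, haf⟩ := mem_filter.1 haf
    refine ⟨a, hR a haR, haf, (hT.total ?_).resolve_right fun h' => hag (mem_filter.2 ⟨haR, h'⟩)⟩
    rintro rfl
    exact hT.asymm (hF g hg) (hR g haR)
  have big : ∀ {f g}, ¬ X f ⊆ X g → #(X f) ≤ #(X g) → ¬ X g ⊆ X f := fun h hc h' =>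
    h (eq_of_subset_of_card_le h' hc).ge
  obtain ⟨f₀, hf₀, a₀, ha₀, ha₀f⟩ := hne
  obtain ⟨q, hq, hqmax⟩ := exists_max_image F (fun f => #(X f)) ⟨f₀, hf₀⟩
  have hqne : ∃ a ∈ R, arc a q := by
    have h1 : 0 < #(X f₀) := card_pos.2 ⟨a₀, mem_filter.2 ⟨ha₀, ha₀f⟩⟩
    obtain ⟨a, ha⟩ := card_pos.1 (h1.trans_le (hqmax f₀ hf₀))
    exact ⟨a, mem_filter.1 ha⟩
  by_cases hall : ∀ f ∈ F, X f ⊆ X q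
  · exact ⟨q, hq, q, hq, Or.inl rfl, hqne, fun f hf => Or.inl (sub f q (hall f hf))⟩
  push Not at hall
  obtain ⟨f₁, hf₁, hf₁q⟩ := hall
  obtain ⟨p, hp, hpmax⟩ := exists_max_image (F.filter fun f => ¬ X f ⊆ X q)
    (fun f => #(X f)) ⟨f₁, mem_filter.2 ⟨hf₁, hf₁q⟩⟩
  obtain ⟨hp, hpq⟩ := mem_filter.1 hp
  have hqp := big hpq (hqmax p hp)
  have hcov : ∀ f ∈ F, X f ⊆ X p ∨ X f ⊆ X q := by
    intro f hf
    by_contra! h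
    exact hL.false_of_incomparable hT hF hf hp hq (nsub f p hp h.1)
      (nsub p f hf (big h.1 (hpmax f (mem_filter.2 ⟨hf, h.2⟩)))) (nsub p q hq hpq)
      (nsub q p hp hqp) (nsub f q hq h.2) (nsub q f hf (big h.2 (hqmax f hf)))
  have hpne : ∃ a ∈ R, arc a p := by
    obtain ⟨a, ha, -⟩ := not_subset.1 hpq
    exact ⟨a, mem_filter.1 ha⟩
  have hne : p ≠ q := fun h => hpq (h ▸ Subset.rfl)
  rcases hT.total hne with h | h
  · exact ⟨p, hp, q, hq, Or.inr h, hqne, fun f hf => (hcov f hf).imp (sub f p) (sub f q)⟩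
  · exact ⟨q, hq, p, hp, Or.inr h, hpne,
      fun f hf => (hcov f hf).symm.imp (sub f q) (sub f p)⟩

theorem IsLight.false_of_two_out (hT : IsTournament arc) (hL : IsLight arc)
    {a b c z x w : V} (ht : Triangle arc a b c) (ha : arc a z) (hb : arc b z) (hc : arc c z)
    (hzx : arc z x) (hxa : arc x a) (hxb : arc x b) (hcx : arc c x) (hzw : arc z w)
    (hwc : arc w c) : False := by
  have hwa : w ≠ a := by
    rintro rfl
    exact hT.asymm ha hzw
  rcases hT.total hwa with h | h
  · exact hL c a b ht.rotate.rotate ⟨z, w, hzw, ⟨hwc, hc⟩, h, ha⟩ ⟨z, x, hzx, ⟨hxa, ha⟩, hxb, hb⟩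
  · exact hL x a z ⟨hxa, ha, hzx⟩ ⟨b, c, ht.2.1, ⟨hcx, hxb⟩, ht.2.2, ht.1⟩
      ⟨w, c, hwc, ⟨ht.2.2, h⟩, hc, hzw⟩

theorem IsLight.false_of_dominated (hT : IsTournament arc) (hL : IsLight arc)
    {a b c z x y w : V} (ht : Triangle arc a b c) (ha : arc a z) (hb : arc b z)
    (hc : arc c z) (hzx : arc z x) (hxa : arc x a) (hzy : arc z y) (hyb : arc y b)
    (hzw : arc z w) (hwc : arc w c) : False := by
  have ne : ∀ {s t}, arc z s → arc t z → s ≠ t := by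
    rintro s _ h1 h2 rfl
    exact hT.asymm h1 h2
  have dom : ∀ v, arc z v → arc v a → arc v b → arc v c → False := fun v hv h1 h2 h3 =>
    hL.not_triangle_of_arc hv ⟨h1, ha⟩ ⟨h2, hb⟩ ⟨h3, hc⟩ ht
  rcases hT.total (ne hzx hb) with h1 | h1
  · rcases hT.total (ne hzx hc) with h2 | h2
    · exact dom x hzx hxa h1 h2
    · exact hL.false_of_two_out hT ht ha hb hc hzx hxa h1 h2 hzw hwc
  rcases hT.total (ne hzx hc) with h2 | h2
  · exact hL.false_of_two_out hT ht.rotate.rotate hc ha hb hzx h2 hxa h1 hzy hyb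
  rcases hT.total (ne hzy ha) with h3 | h3
  · rcases hT.total (ne hzy hc) with h4 | h4
    · exact dom y hzy h3 hyb h4
    · exact hL.false_of_two_out hT ht ha hb hc hzy h3 hyb h4 hzw hwc
  rcases hT.total (ne hzy hc) with h4 | h4
  · exact hL.false_of_two_out hT ht.rotate hb hc ha hzy hyb h4 h3 hzx hxa
  rcases hT.total (ne hzw ha) with h5 | h5
  · rcases hT.total (ne hzw hb) with h6 | h6
    · exact dom w hzw h5 h6 hwc
    · exact hL.false_of_two_out hT ht.rotate.rotate hc ha hb hzw hwc h5 h6 hzy hyb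
  rcases hT.total (ne hzw hb) with h6 | h6
  · exact hL.false_of_two_out hT ht.rotate hb hc ha hzw h6 hwc h5 hzx hxa
  have hxy : x ≠ y := by
    rintro rfl
    exact hT.asymm hxa h3
  rcases hT.total hxy with h | h
  · exact hL a z x ⟨ha, hzx, hxa⟩ ⟨w, c, hwc, ⟨ht.2.2, h5⟩, hc, hzw⟩
      ⟨y, b, hyb, ⟨hb, hzy⟩, h1, h⟩
  · exact hL b z y ⟨hb, hzy, hyb⟩ ⟨x, a, hxa, ⟨ht.1, h1⟩, ha, hzx⟩
      ⟨x, a, hxa, ⟨ha, hzx⟩, h3, h⟩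

open Classical in
/-- The in-neighbourhood of a vertex of minimum in-degree contains no triangle. -/
theorem IsLight.exists_inNeighbors_not_triangle (hT : IsTournament arc) (hL : IsLight arc)
    {R : Finset V} (hR : R.Nonempty) :
    ∃ z ∈ R, ∀ a b c, a ∈ R → b ∈ R → c ∈ R → arc a z → arc b z → arc c z →
      ¬ Triangle arc a b c := by
  obtain ⟨z, hz, hmin⟩ := exists_min_image R (fun v => #(R.filter (arc · v))) hR
  have key : ∀ a ∈ R, arc a z → ∃ x, arc z x ∧ arc x a := by
    intro a ha haz
    by_contra! h
    refine (hmin a ha).not_gt (card_lt_card ?_)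
    refine (ssubset_iff_of_subset fun v hv => ?_).2 ⟨a, by simp [ha, haz], by simp [hT.1 a]⟩
    obtain ⟨hvR, hva⟩ := mem_filter.1 hv
    refine mem_filter.2 ⟨hvR, (hT.total ?_).resolve_right fun h' => h v h' hva⟩
    rintro rfl
    exact hT.asymm haz hva
  refine ⟨z, hz, fun a b c ha hb hc haz hbz hcz ht => ?_⟩
  obtain ⟨x, hzx, hxa⟩ := key a ha haz
  obtain ⟨y, hzy, hyb⟩ := key b hb hbz
  obtain ⟨w, hzw, hwc⟩ := key c hc hcz
  exact hL.false_of_dominated hT ht haz hbz hcz hzx hxa hzy hyb hzw hwc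

/-- `col` has no monochromatic triangle outside `R`. -/
def ProperOff (arc : V → V → Prop) (col : V → Fin 3) (R : Finset V) : Prop :=
  ∀ a b c, a ∉ R → b ∉ R → c ∉ R → Triangle arc a b c → ¬ (col a = col b ∧ col b = col c)

/-- A partial colouring in which only the set `R`, dominated by `r`, remains to be
coloured, `W` is the most recently coloured set, and the other coloured vertices that
receive arcs from `R` do so only from in-neighbours of a vertex `p`. -/
structure PartialColoring (arc : V → V → Prop) (R W : Finset V) (col : V → Fin 3)
    (c₁ c₂ : Fin 3) (r : V) : Prop where
  ne : c₁ ≠ c₂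
  disj : ∀ v ∈ W, v ∉ R
  proper : ProperOff arc col R
  root_arc : ∀ v ∈ R, arc r v
  arc_root : ∀ w ∈ W, arc w r
  col_eq : ∀ w ∈ W, col w = c₂
  col_eq_of_arc : ∀ l, l ∉ R → l ∉ W → ∀ a ∈ R, arc a l → col l = c₁
  tail : (∀ l, l ∉ R → l ∉ W → ∀ a ∈ R, ¬ arc a l) ∨
    ∃ p s, p ∉ R ∧ arc p s ∧ arc p r ∧ arc r s ∧ (∀ v ∈ W, arc s v) ∧
      (∀ v ∈ R, arc s v) ∧ ∀ l, l ∉ R → l ∉ W → ∀ a ∈ R, arc a l → arc a p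

/-- The next part to be coloured is the in-neighbourhood of `q` in `R`. -/
theorem PartialColoring.exists_cover (hT : IsTournament arc) (hL : IsLight arc)
    {R W : Finset V} {col : V → Fin 3} {c₁ c₂ : Fin 3} {r : V}
    (h : PartialColoring arc R W col c₁ c₂ r) :
    (∀ l, l ∉ R → ∀ a ∈ R, ¬ arc a l) ∨
      ∃ p q, p ∉ R ∧ arc p r ∧ arc q r ∧ (p = q ∨ arc p q) ∧ (∃ a ∈ R, arc a q) ∧
        (∀ l, l ∉ R → l ∉ W → ∀ a ∈ R, arc a l → arc a q) ∧
        ∀ l ∈ W, ∀ a ∈ R, arc a l → arc a p ∨ arc a q := by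
  classical
  rcases h.tail with htail | ⟨p₀, s, hp₀, hps, hpr, hrs, hsW, hsR, htail⟩
  · by_cases hne : ∃ f ∈ W, ∃ a ∈ R, arc a f
    · obtain ⟨p, hp, q, hq, hpq, hqne, hcov⟩ :=
        hL.exists_cover hT h.arc_root h.root_arc hne
      exact Or.inr ⟨p, q, h.disj p hp, h.arc_root p hp, h.arc_root q hq, hpq, hqne,
        fun l hl hlW a ha hal => (htail l hl hlW a ha hal).elim,
        fun l hl a ha hal => (hcov l hl).imp (· a ha hal) (· a ha hal)⟩
    · push Not at hne
      exact Or.inl fun l hl a ha hal => by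
        by_cases hlW : l ∈ W
        · exact hne l hlW a ha hal
        · exact htail l hl hlW a ha hal
  · have hF : ∀ f ∈ insert p₀ W, arc f r := by
      intro f hf
      rcases mem_insert.1 hf with rfl | hf
      exacts [hpr, h.arc_root f hf]
    have hFR : ∀ f ∈ insert p₀ W, f ∉ R := by
      intro f hf
      rcases mem_insert.1 hf with rfl | hf
      exacts [hp₀, h.disj f hf]
    by_cases hne : ∃ f ∈ insert p₀ W, ∃ a ∈ R, arc a f
    · obtain ⟨p, hp, q, hq, hpq, hqne, hcov⟩ := hL.exists_cover hT hF h.root_arc hne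
      refine Or.inr ⟨p, q, hFR p hp, hF p hp, hF q hq, hpq, hqne, fun l hl hlW a ha hal => ?_,
        fun l hl a ha hal => (hcov l (mem_insert_of_mem hl)).imp (· a ha hal) (· a ha hal)⟩
      have hap₀ := htail l hl hlW a ha hal
      have hra := h.root_arc a ha
      by_contra haq
      have hqa : arc q a := (hT.total (by rintro rfl; exact hFR q hq ha)).resolve_right haq
      have hap : arc a p :=
        (hcov p₀ (mem_insert_self _ _)).elim (· a ha hap₀) fun h' => (haq (h' a ha hap₀)).elim
      have hqW : q ∈ W := (mem_insert.1 hq).resolve_left fun h' => haq (h' ▸ hap₀)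
      have hpq : arc p q := hpq.resolve_left fun h' => haq (h' ▸ hap)
      rcases mem_insert.1 hp with rfl | hpW
      · exact hL.not_triangle_of_arc hap ⟨hpq, hqa⟩ ⟨hpr, hra⟩ ⟨hps, hsR a ha⟩
          ⟨hF q hq, hrs, hsW q hqW⟩
      · exact hL q r s ⟨hF q hq, hrs, hsW q hqW⟩ ⟨a, p, hap, ⟨hpq, hqa⟩, hF p hp, hra⟩
          ⟨a, p₀, hap₀, ⟨hpr, hra⟩, hps, hsR a ha⟩
    · push Not at hne
      exact Or.inl fun l hl a ha hal => by
        by_cases hlW : l ∈ W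
        · exact hne l (mem_insert_of_mem hlW) a ha hal
        · exact hne p₀ (mem_insert_self _ _) a ha (htail l hl hlW a ha hal)

theorem PartialColoring.extend (hT : IsTournament arc) (hL : IsLight arc)
    {R W : Finset V} {col : V → Fin 3} {c₁ c₂ : Fin 3} {r : V}
    (h : PartialColoring arc R W col c₁ c₂ r) :
    (∀ l, l ∉ R → ∀ a ∈ R, ¬ arc a l) ∨
      ∃ R' ⊂ R, ∃ W' col' c₃ r', PartialColoring arc R' W' col' c₂ c₃ r' := by
  classical
  rcases h.exists_cover hT hL with hcl | ⟨p, q, hpR, hpr, hqr, hpq, ⟨a₀, ha₀, ha₀q⟩, hO, hW⟩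
  · exact Or.inl hcl
  right
  obtain ⟨c₃, h31, h32⟩ : ∃ c₃ : Fin 3, c₃ ≠ c₁ ∧ c₃ ≠ c₂ := by
    clear h
    revert c₁ c₂
    decide
  have hmem : ∀ v, v ∈ R.filter (fun v => ¬ arc v q) ↔ v ∈ R ∧ ¬ arc v q := by simp
  have hmem' : ∀ v, v ∈ R.filter (arc · q) ↔ v ∈ R ∧ arc v q := by simp
  have hqR : q ∉ R := fun hq => hT.asymm hqr (h.root_arc q hq)
  have hout : ∀ l, l ∉ R.filter (fun v => ¬ arc v q) → l ∉ R.filter (arc · q) → l ∉ R := by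
    intro l h1 h2 hl
    rw [hmem] at h1
    rw [hmem'] at h2
    tauto
  refine ⟨R.filter fun v => ¬ arc v q, ?_, R.filter (arc · q),
    fun v => if v ∈ R then c₃ else col v, c₃, q, ?_⟩
  · exact (ssubset_iff_of_subset (filter_subset _ _)).2 ⟨a₀, ha₀, by simp [ha₀q]⟩
  · refine ⟨h32.symm, ?_, ?_, ?_, ?_, ?_, ?_, ?_⟩
    · intro v hv
      rw [hmem'] at hv
      rw [hmem]
      tauto
    · have hmix : ∀ a b, a ∈ R → b ∉ R → arc a b →
          ¬ ((if a ∈ R then c₃ else col a) = if b ∈ R then c₃ else col b) := by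
        intro a b ha hb hab
        rw [if_pos ha, if_neg hb]
        by_cases hbW : b ∈ W
        · rw [h.col_eq b hbW]
          exact h32
        · rw [h.col_eq_of_arc b hb hbW a ha hab]
          exact h31
      rintro a b c ha hb hc ht ⟨hab, hbc⟩
      have hq : ∀ v, v ∉ R.filter (fun v => ¬ arc v q) → v ∈ R → arc v q := by
        intro v hv
        rw [hmem] at hv
        tauto
      by_cases haR : a ∈ R
      · by_cases hbR : b ∈ R
        · by_cases hcR : c ∈ R
          · exact hL.not_triangle_of_arc hqr ⟨h.root_arc a haR, hq a ha haR⟩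
              ⟨h.root_arc b hbR, hq b hb hbR⟩ ⟨h.root_arc c hcR, hq c hc hcR⟩ ht
          · exact hmix b c hbR hcR ht.2.1 hbc
        · exact hmix a b haR hbR ht.1 hab
      · by_cases hcR : c ∈ R
        · exact hmix c a hcR haR ht.2.2 (hab.trans hbc).symm
        · by_cases hbR : b ∈ R
          · exact hmix b c hbR hcR ht.2.1 hbc
          · simp only [if_neg haR, if_neg hbR, if_neg hcR] at hab hbc
            exact h.proper a b c haR hbR hcR ht ⟨hab, hbc⟩
    · intro v hv
      rw [hmem] at hv
      exact (hT.total (by rintro rfl; exact hqR hv.1)).resolve_right hv.2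
    · exact fun w hw => ((hmem' w).1 hw).2
    · exact fun w hw => if_pos ((hmem' w).1 hw).1
    · intro l hl hl' a ha hal
      have hlR := hout l hl hl'
      rw [hmem] at ha
      rw [if_neg hlR]
      by_cases hlW : l ∈ W
      · exact h.col_eq l hlW
      · exact (ha.2 (hO l hlR hlW a ha.1 hal)).elim
    · have hp : ∀ l, l ∉ R.filter (fun v => ¬ arc v q) → l ∉ R.filter (arc · q) →
          ∀ a ∈ R.filter (fun v => ¬ arc v q), arc a l → arc a p := by
        intro l hl hl' a ha hal
        have hlR := hout l hl hl'
        rw [hmem] at ha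
        by_cases hlW : l ∈ W
        · exact (hW l hlW a ha.1 hal).resolve_right ha.2
        · exact (ha.2 (hO l hlR hlW a ha.1 hal)).elim
      rcases hpq with rfl | hpq
      · exact Or.inl fun l hl hl' a ha hal => ((hmem a).1 ha).2 (hp l hl hl' a ha hal)
      · refine Or.inr ⟨p, r, fun hp' => hpR ((hmem p).1 hp').1, hpr, hpq, hqr,
          fun v hv => h.root_arc v ((hmem' v).1 hv).1,
          fun v hv => h.root_arc v ((hmem v).1 hv).1, hp⟩

theorem ProperOff.exists_partialColoring (hT : IsTournament arc) (hL : IsLight arc)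
    {R : Finset V} {col : V → Fin 3} (hR : R.Nonempty) (hcol : ProperOff arc col R)
    (hcl : ∀ l, l ∉ R → ∀ a ∈ R, ¬ arc a l) :
    ∃ R' ⊂ R, ∃ W' col' c₁ c₂ r', PartialColoring arc R' W' col' c₁ c₂ r' := by
  classical
  obtain ⟨z, hz, hacyc⟩ := hL.exists_inNeighbors_not_triangle hT hR
  have hmem : ∀ v, v ∈ R.filter (arc z ·) ↔ v ∈ R ∧ arc z v := by simp
  have hmem' : ∀ v, v ∈ R.filter (arc · z) ↔ v ∈ R ∧ arc v z := by simp
  have hin : ∀ v, v ∉ R.filter (arc z ·) → v ∈ R → v ≠ z → arc v z := by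
    intro v hv hvR hvz
    rw [hmem] at hv
    exact (hT.total hvz).resolve_right fun h => hv ⟨hvR, h⟩
  have hno : ∀ l, l ∉ R.filter (arc z ·) → l ∉ R.filter (arc · z) →
      ∀ a ∈ R.filter (arc z ·), ¬ arc a l := by
    intro l hl hl' a ha hal
    rw [hmem] at ha
    by_cases hlR : l ∈ R
    · by_cases hlz : l = z
      · subst hlz
        exact hT.asymm ha.2 hal
      · exact hl' ((hmem' l).2 ⟨hlR, hin l hl hlR hlz⟩)
    · exact hcl l hlR a ha.1 hal
  refine ⟨R.filter (arc z ·), ?_, R.filter (arc · z),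
    fun v => if v = z then 0 else if v ∈ R then 1 else col v, 0, 1, z, ?_⟩
  · exact (ssubset_iff_of_subset (filter_subset _ _)).2 ⟨z, hz, by simp [hT.1 z]⟩
  · refine ⟨by decide, ?_, ?_, fun v hv => ((hmem v).1 hv).2, fun v hv => ((hmem' v).1 hv).2,
      ?_, fun l hl hl' a ha hal => (hno l hl hl' a ha hal).elim, Or.inl hno⟩
    · intro v hv
      rw [hmem'] at hv
      rw [hmem]
      exact fun h => hT.asymm hv.2 h.2
    · rintro a b c ha hb hc ht ⟨hab, hbc⟩
      have hclosed : ∀ {u v}, arc u v → u ∈ R → v ∈ R := fun {u v} huv hu => by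
        by_contra hv
        exact hcl v hv u hu huv
      by_cases haR : a ∈ R
      · have hbR := hclosed ht.1 haR
        have hcR := hclosed ht.2.1 hbR
        by_cases haz : a = z <;> by_cases hbz : b = z <;> by_cases hcz : c = z <;>
          simp only [haz, hbz, hcz, haR, hbR, hcR, hz, if_true, if_false, one_ne_zero,
            zero_ne_one] at hab hbc
        · rw [haz, hbz] at ht
          exact hT.1 z ht.1
        · exact hacyc a b c haR hbR hcR (hin a ha haR haz) (hin b hb hbR hbz)
            (hin c hc hcR hcz) ht
      · have hcR : c ∉ R := fun h => haR (hclosed ht.2.2 h)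
        have hbR : b ∉ R := fun h => hcR (hclosed ht.2.1 h)
        have hne : ∀ {v}, v ∉ R → v ≠ z := by
          rintro v hv rfl
          exact hv hz
        simp only [if_neg haR, if_neg hbR, if_neg hcR, if_neg (hne haR), if_neg (hne hbR),
          if_neg (hne hcR)] at hab hbc
        exact hcol a b c haR hbR hcR ht ⟨hab, hbc⟩
    · intro w hw
      rw [hmem'] at hw
      have hwz : w ≠ z := by
        rintro rfl
        exact hT.1 w hw.2
      simp only [if_neg hwz, if_pos hw.1]

theorem IsLight.exists_proper_of_state (hT : IsTournament arc) (hL : IsLight arc)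
    (R : Finset V) :
    (∀ col, ProperOff arc col R → (∀ l, l ∉ R → ∀ a ∈ R, ¬ arc a l) →
      ∃ col', ProperOff arc col' ∅) ∧
    ∀ W col c₁ c₂ r, PartialColoring arc R W col c₁ c₂ r → ∃ col', ProperOff arc col' ∅ := by
  induction R using Finset.strongInduction with
  | H R ih =>
    have hclosed : ∀ col, ProperOff arc col R → (∀ l, l ∉ R → ∀ a ∈ R, ¬ arc a l) →
        ∃ col', ProperOff arc col' ∅ := by
      intro col hcol hcl
      rcases R.eq_empty_or_nonempty with rfl | hne
      · exact ⟨col, hcol⟩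
      · obtain ⟨R', hR', W', col', c₁, c₂, r', h⟩ :=
          hcol.exists_partialColoring hT hL hne hcl
        exact (ih R' hR').2 W' col' c₁ c₂ r' h
    refine ⟨hclosed, fun W col c₁ c₂ r h => ?_⟩
    rcases h.extend hT hL with hcl | ⟨R', hR', W', col', c₃, r', h'⟩
    · exact hclosed col h.proper hcl
    · exact (ih R' hR').2 W' col' c₂ c₃ r' h'

/-- A light tournament has a vertex partition into three transitive subtournaments. -/
theorem IsLight.exists_coloring [Finite V] (hT : IsTournament arc) (hL : IsLight arc) :
    ∃ col : V → Fin 3, ∀ a b c, Triangle arc a b c → ¬ (col a = col b ∧ col b = col c) := by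
  have := Fintype.ofFinite V
  obtain ⟨col, hcol⟩ := (hL.exists_proper_of_state hT univ).1 (fun _ => 0)
    (fun a _ _ ha => (ha (mem_univ a)).elim) (fun l hl => (hl (mem_univ l)).elim)
  exact ⟨col, fun a b c => hcol a b c (notMem_empty a) (notMem_empty b) (notMem_empty c)⟩

end Light

section Rounding

variable {arc : V → V → Prop} {x : V → ℝ} {y : V → V → ℝ}

theorem IsTournament.subtype (hT : IsTournament arc) (p : V → Prop) :
    IsTournament fun a b : {v // p v} => arc a b :=
  ⟨fun v => hT.1 v, fun a b h => hT.2 a b fun h' => h (Subtype.ext h')⟩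

theorem SA1Feasible.one_le_of_triangle (hT : IsTournament arc) (h : SA1Feasible arc x y)
    {a b c : V} (ht : Triangle arc a b c) : 1 ≤ x a + x b + x c := by
  have hab : a ≠ b := fun e => hT.1 a (e ▸ ht.1)
  have hbc : b ≠ c := fun e => hT.1 b (e ▸ ht.2.1)
  have h1 := h.2.2.1 a b c ht
  have h2 := (h.2.2.2.2 a b hab).2
  have h3 := (h.2.2.2.2 b c hbc).2
  linarith

theorem SA1Feasible.le_of_isDiagonal (hT : IsTournament arc) (h : SA1Feasible arc x y)
    {a b u v : V} (hab : a ≠ b) (huv : arc u v) (ha : arc v a ∧ arc a u)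
    (hb : arc v b ∧ arc b u) : 1 - x u - x v ≤ y a b := by
  have hbu : b ≠ u := fun e => hT.1 b (by simpa [← e] using hb.2)
  have hbv : b ≠ v := fun e => hT.1 b (by simpa [← e] using hb.1)
  have h1 := (h.2.2.2.1 u v a b ⟨huv, ha⟩ hbu hbv hab.symm).1
  have h2 := h.2.2.1 v b u ⟨hb.1, hb.2, huv⟩
  rw [h.1 b u] at h2
  linarith

theorem SA1Feasible.isLight (hT : IsTournament arc) (h : SA1Feasible arc x y) :
    IsLight fun a b : {v // x v < 3 / 7} => arc a b := by
  rintro ⟨a, hxa⟩ ⟨b, hxb⟩ ⟨c, hxc⟩ ht ⟨⟨u, hxu⟩, ⟨v, hxv⟩, huv, ha, hb⟩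
    ⟨⟨u', hxu'⟩, ⟨v', hxv'⟩, huv', hb', hc'⟩
  simp only at *
  have ht : Triangle arc a b c := ht
  have hab : a ≠ b := fun e => hT.1 a (e ▸ ht.1)
  have hbc : b ≠ c := fun e => hT.1 b (e ▸ ht.2.1)
  have h1 := h.le_of_isDiagonal hT hab huv ha hb
  have h2 := h.le_of_isDiagonal hT hbc huv' hb' hc'
  have h3 := h.2.2.1 a b c ht
  linarith

theorem SA1Feasible.exists_coloring [Finite V] (hT : IsTournament arc)
    (h : SA1Feasible arc x y) :
    ∃ col : V → Fin 3, ∀ a b c, x a < 3 / 7 → x b < 3 / 7 → x c < 3 / 7 →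
      Triangle arc a b c → ¬ (col a = col b ∧ col b = col c) := by
  classical
  obtain ⟨col, hcol⟩ := (h.isLight hT).exists_coloring (hT.subtype _)
  refine ⟨fun v => if hv : x v < 3 / 7 then col ⟨v, hv⟩ else 0, fun a b c ha hb hc ht => ?_⟩
  simpa [ha, hb, hc] using hcol ⟨a, ha⟩ ⟨b, hb⟩ ⟨c, hc⟩ ht

/-- The vertices which are not deleted by threshold rounding with threshold `s` and
colour `i`. -/
def Kept (x : V → ℝ) (col : V → Fin 3) (s : ℝ) (i : Fin 3) (v : V) : Prop :=
  x v ≤ 1 / 7 ∨ x v < s ∨ (col v = i ∧ x v < (1 - s) / 2)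

theorem SA1Feasible.isFVS_not_kept (hT : IsTournament arc) (h : SA1Feasible arc x y)
    {col : V → Fin 3} (hcol : ∀ a b c, x a < 3 / 7 → x b < 3 / 7 → x c < 3 / 7 →
      Triangle arc a b c → ¬ (col a = col b ∧ col b = col c))
    {s : ℝ} (hs : 1 / 7 ≤ s) (hs' : s ≤ 1 / 3) (i : Fin 3) :
    IsFVS arc {v | ¬ Kept x col s i v} := by
  intro a b c ha hb hc ht
  simp only [Set.mem_ofPred_eq, not_not] at ha hb hc
  have hsum := h.one_le_of_triangle hT ht
  have hlt : ∀ v, Kept x col s i v → x v < (1 - s) / 2 := by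
    rintro v (hv | hv | ⟨-, hv⟩) <;> linarith
  have hlta := hlt a ha
  have hltb := hlt b hb
  have hltc := hlt c hc
  have hcol_eq : ∀ v, Kept x col s i v → s ≤ x v → 1 / 7 < x v → col v = i := by
    rintro v (hv | hv | ⟨hv, -⟩) h1 h2
    · linarith
    · linarith
    · exact hv
  have ea := hcol_eq a ha (by linarith) (by linarith)
  have eb := hcol_eq b hb (by linarith) (by linarith)
  have ec := hcol_eq c hc (by linarith) (by linarith)
  exact hcol a b c (by linarith) (by linarith) (by linarith) ht
    ⟨ea.trans eb.symm, eb.trans ec.symm⟩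

open Classical in
theorem sum_not_kept (x : V → ℝ) (col : V → Fin 3) (s : ℝ) (v : V) :
    ∑ i, (if Kept x col s i v then (0 : ℝ) else 1) =
      if x v ≤ 1 / 7 ∨ x v < s then 0 else if x v < (1 - s) / 2 then 2 else 3 := by
  by_cases h1 : x v ≤ 1 / 7 <;> by_cases h2 : x v < s <;> by_cases h3 : x v < (1 - s) / 2 <;>
    simp only [Kept, h1, h2, h3, true_or, or_true, or_self, false_or, and_true, and_false,
      if_true, if_false, Fin.sum_univ_three] <;> norm_num
  rcases (by omega : col v = 0 ∨ col v = 1 ∨ col v = 2) with h | h | h <;> simp [h] <;> norm_num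

open Classical in
theorem sum_not_kept_le {v : V} (hx : 0 ≤ x v) (col : V → Fin 3) :
    ∑ i, (if Kept x col (1 / 7) i v then (0 : ℝ) else 1) +
      ∑ i, (if Kept x col (2 / 7) i v then (0 : ℝ) else 1) ≤ 14 * x v := by
  rw [sum_not_kept, sum_not_kept]
  split_ifs <;> grind

theorem SA1Feasible.exists_isFVS [Fintype V] (hT : IsTournament arc)
    (h : SA1Feasible arc x y) {w : V → ℝ} (hw : ∀ v, 0 ≤ w v) :
    ∃ X : Finset V, IsFVS arc (↑X : Set V) ∧ ∑ v ∈ X, w v ≤ 7 / 3 * ∑ v, w v * x v := by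
  classical
  obtain ⟨col, hcol⟩ := h.exists_coloring hT
  let X : ℝ → Fin 3 → Finset V := fun s i => univ.filter fun v => ¬ Kept x col s i v
  have hX : ∀ s i, 1 / 7 ≤ s → s ≤ 1 / 3 → IsFVS arc (↑(X s i) : Set V) := by
    intro s i hs hs'
    simpa [X] using h.isFVS_not_kept hT hcol hs hs' i
  have hsum : ∀ s, ∑ i, ∑ v ∈ X s i, w v =
      ∑ v, w v * ∑ i, (if Kept x col s i v then (0 : ℝ) else 1) := by
    intro s
    simp only [X, sum_filter, mul_sum]
    rw [sum_comm]
    refine sum_congr rfl fun v _ => sum_congr rfl fun i _ => ?_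
    split_ifs <;> simp_all
  have htotal : ∑ i, (∑ v ∈ X (1 / 7) i, w v + ∑ v ∈ X (2 / 7) i, w v) ≤
      ∑ _i : Fin 3, 14 / 3 * ∑ v, w v * x v := by
    rw [sum_add_distrib, hsum, hsum, ← sum_add_distrib, sum_const, card_univ, Fintype.card_fin,
      nsmul_eq_mul, ← mul_assoc, mul_sum]
    refine sum_le_sum fun v _ => ?_
    have := mul_le_mul_of_nonneg_left (sum_not_kept_le (h.2.1 v).1 col) (hw v)
    push_cast
    linarith
  obtain ⟨i, -, hi⟩ := exists_le_of_sum_le univ_nonempty htotal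
  rcases le_total (∑ v ∈ X (1 / 7) i, w v) (∑ v ∈ X (2 / 7) i, w v) with hle | hle
  · exact ⟨X (1 / 7) i, hX _ i (by norm_num) (by norm_num), by linarith⟩
  · exact ⟨X (2 / 7) i, hX _ i (by norm_num) (by norm_num), by linarith⟩

theorem sa1Feasible_const (arc : V → V → Prop) :
    SA1Feasible arc (fun _ => 3 / 7) fun _ _ => 1 / 7 := by
  refine ⟨?_, ?_, ?_, ?_, ?_⟩ <;> intros <;> norm_num

theorem SA1Val_le_sum [Fintype V] (arc : V → V → Prop) {w : V → ℚ} (hw : ∀ v, 0 ≤ w v) :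
    SA1Val arc w ≤ ∑ v, (w v : ℝ) * (3 / 7) := by
  refine csInf_le ⟨0, ?_⟩ ⟨_, _, sa1Feasible_const arc, rfl⟩
  rintro t ⟨x, y, h, rfl⟩
  exact sum_nonneg fun v _ => mul_nonneg (by exact_mod_cast hw v) (h.2.1 v).1

theorem SA1Val_nonneg [Fintype V] (arc : V → V → Prop) {w : V → ℚ} (hw : ∀ v, 0 ≤ w v) :
    0 ≤ SA1Val arc w := by
  refine Real.sInf_nonneg ?_
  rintro t ⟨x, y, h, rfl⟩
  exact sum_nonneg fun v _ => mul_nonneg (by exact_mod_cast hw v) (h.2.1 v).1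

theorem exists_isFVS_le_SA1Val [Fintype V] (hT : IsTournament arc) {w : V → ℚ}
    (hw : ∀ v, 0 ≤ w v) :
    ∃ X : Finset V, IsFVS arc (↑X : Set V) ∧ ∑ v ∈ X, (w v : ℝ) ≤ 7 / 3 * SA1Val arc w := by
  classical
  obtain ⟨X, hX, hmin⟩ := exists_min_image
    (univ.filter fun X : Finset V => IsFVS arc (↑X : Set V)) (fun X => ∑ v ∈ X, (w v : ℝ))
    ⟨univ, by simp [IsFVS]⟩
  refine ⟨X, (mem_filter.1 hX).2, ?_⟩
  suffices h : 3 / 7 * ∑ v ∈ X, (w v : ℝ) ≤ SA1Val arc w by linarith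
  refine le_csInf ⟨_, _, _, sa1Feasible_const arc, rfl⟩ ?_
  rintro t ⟨x, y, h, rfl⟩
  obtain ⟨Y, hY, hle⟩ := h.exists_isFVS hT (w := fun v => (w v : ℝ))
    fun v => by exact_mod_cast hw v
  have := hmin Y (mem_filter.2 ⟨mem_univ _, hY⟩)
  linarith

end Rounding

/-- The substitution of `arc` into every vertex of a directed triangle. -/
def tripleArc (arc : V → V → Prop) (a b : Fin 3 × V) : Prop :=
  b.1 = a.1 + 1 ∨ a.1 = b.1 ∧ arc a.2 b.2

theorem IsTournament.tripleArc {arc : V → V → Prop} (hT : IsTournament arc) :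
    IsTournament (tripleArc arc) := by
  have hsucc : ∀ i : Fin 3, i ≠ i + 1 := by decide
  have hswap : ∀ i j : Fin 3, i ≠ j → (j = i + 1 ↔ ¬ i = j + 1) := by decide
  refine ⟨?_, ?_⟩
  · rintro ⟨i, v⟩ (h | ⟨-, h⟩)
    · exact hsucc i h
    · exact hT.1 v h
  · rintro ⟨i, a⟩ ⟨j, b⟩ hne
    simp only [_root_.tripleArc]
    by_cases hij : i = j
    · subst hij
      simpa [hsucc i] using hT.2 a b fun h => hne (by rw [h])
    · simpa [hij, Ne.symm hij] using hswap i j hij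

theorem card_le_two_mul_of_tripleArc {arc : V → V → Prop} {m : ℕ}
    (hm : ∀ S : Finset V, (∀ a ∈ S, ∀ b ∈ S, ∀ c ∈ S, ¬ Triangle arc a b c) → #S ≤ m)
    {S : Finset (Fin 3 × V)}
    (hS : ∀ a ∈ S, ∀ b ∈ S, ∀ c ∈ S, ¬ Triangle (tripleArc arc) a b c) : #S ≤ 2 * m := by
  classical
  have hfib : ∀ i, #(S.filter fun a => a.1 = i) ≤ m := by
    intro i
    rw [← card_image_of_injOn (f := Prod.snd)]
    · refine hm _ ?_
      simp only [mem_image, mem_filter]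
      rintro _ ⟨⟨_, a⟩, ⟨ha, rfl⟩, rfl⟩ _ ⟨⟨_, b⟩, ⟨hb, rfl⟩, rfl⟩ _ ⟨⟨_, c⟩, ⟨hc, rfl⟩, rfl⟩ ht
      exact hS _ ha _ hb _ hc ⟨Or.inr ⟨rfl, ht.1⟩, Or.inr ⟨rfl, ht.2.1⟩, Or.inr ⟨rfl, ht.2.2⟩⟩
    · rintro ⟨i, a⟩ ha ⟨j, b⟩ hb h
      simp_all
  have hempty : ∃ i, #(S.filter fun a => a.1 = i) = 0 := by
    by_contra! h
    have hmem : ∀ i, ∃ v, (i, v) ∈ S := by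
      intro i
      obtain ⟨a, ha⟩ := card_pos.1 (Nat.pos_of_ne_zero (h i))
      obtain ⟨haS, rfl⟩ := mem_filter.1 ha
      exact ⟨a.2, haS⟩
    obtain ⟨a, ha⟩ := hmem 0
    obtain ⟨b, hb⟩ := hmem 1
    obtain ⟨c, hc⟩ := hmem 2
    exact hS _ ha _ hb _ hc ⟨Or.inl rfl, Or.inl rfl, Or.inl rfl⟩
  have hcard : #S = ∑ i, #(S.filter fun a => a.1 = i) :=
    card_eq_sum_card_fiberwise fun a _ => mem_univ a.1
  rw [hcard, Fin.sum_univ_three]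
  have h0 := hfib 0
  have h1 := hfib 1
  have h2 := hfib 2
  obtain ⟨i, hi⟩ := hempty
  fin_cases i <;> simp only [Fin.zero_eta, Fin.mk_one, Fin.reduceFinMk] at hi <;> omega

/-- There are tournaments on `3 ^ k` vertices whose transitive subtournaments have at most
`2 ^ k` vertices. -/
theorem exists_tournament_card_le (k : ℕ) :
    ∃ arc : Fin (3 ^ k) → Fin (3 ^ k) → Prop, IsTournament arc ∧ ∀ S : Finset (Fin (3 ^ k)),
      (∀ a ∈ S, ∀ b ∈ S, ∀ c ∈ S, ¬ Triangle arc a b c) → #S ≤ 2 ^ k := by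
  induction k with
  | zero =>
    refine ⟨fun _ _ => False, ⟨fun _ => id, fun a b h => ?_⟩, fun S _ => ?_⟩
    · exact (h (Subsingleton.elim (α := Fin 1) a b)).elim
    · simpa using card_le_univ S
  | succ k ih =>
    obtain ⟨arc, hT, hS⟩ := ih
    let e : Fin (3 ^ (k + 1)) ≃ Fin 3 × Fin (3 ^ k) :=
      Fintype.equivOfCardEq (by simp [pow_succ, mul_comm])
    refine ⟨fun a b => tripleArc arc (e a) (e b), ⟨fun v => hT.tripleArc.1 _, fun a b h =>
      hT.tripleArc.2 _ _ (e.injective.ne h)⟩, fun S hS' => ?_⟩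
    rw [← card_map e.toEmbedding, pow_succ 2 k, mul_comm (2 ^ k)]
    refine card_le_two_mul_of_tripleArc hS ?_
    simp only [mem_map_equiv]
    intro a ha b hb c hc ht
    refine hS' _ ha _ hb _ hc ?_
    simpa [Triangle] using ht

/-- The worst-case integrality gap of `SA₁` for FVST is exactly `7/3`: for every
`ε > 0` some unit-weight tournament has `OPT ≥ (7/3 - ε)·SA₁`, and conversely every
weighted tournament has a feedback vertex set of weight at most `(7/3)·SA₁`. -/
theorem stmt13 (ε : ℝ) (hε : 0 < ε) :
    (∃ (n : ℕ) (arc : Fin n → Fin n → Prop), IsTournament arc ∧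
      ∀ X : Finset (Fin n), IsFVS arc (↑X : Set (Fin n)) →
        (7 / 3 - ε) * SA1Val arc (fun _ => 1) ≤ (X.card : ℝ)) ∧
    (∀ (n : ℕ) (arc : Fin n → Fin n → Prop) (w : Fin n → ℚ),
      IsTournament arc → (∀ v, 0 ≤ w v) →
      ∃ X : Finset (Fin n), IsFVS arc (↑X : Set (Fin n)) ∧
        (∑ v ∈ X, (w v : ℝ)) ≤ 7 / 3 * SA1Val arc w) := by
  refine ⟨?_, fun n arc w hT hw => exists_isFVS_le_SA1Val hT hw⟩
  obtain ⟨k, hk⟩ := exists_pow_lt_of_lt_one (show 0 < 3 / 7 * ε by positivity)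
    (show (2 / 3 : ℝ) < 1 by norm_num)
  obtain ⟨arc, hT, hS⟩ := exists_tournament_card_le k
  refine ⟨3 ^ k, arc, hT, fun X hX => ?_⟩
  have hcompl : #Xᶜ ≤ 2 ^ k := hS _ fun a ha b hb c hc =>
    hX a b c (by simpa using ha) (by simpa using hb) (by simpa using hc)
  have hcard : (3 : ℝ) ^ k ≤ #X + 2 ^ k := by
    have h := card_add_card_compl X
    rw [Fintype.card_fin] at h
    exact_mod_cast h ▸ Nat.add_le_add_left hcompl _
  have h0 := SA1Val_nonneg arc (w := fun _ => 1) fun _ => zero_le_one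
  have h1 := SA1Val_le_sum arc (w := fun _ => 1) fun _ => zero_le_one
  simp only [Rat.cast_one, one_mul, sum_const, card_univ, Fintype.card_fin, nsmul_eq_mul,
    Nat.cast_pow, Nat.cast_ofNat] at h1
  have h2 : (2 : ℝ) ^ k < 3 / 7 * ε * 3 ^ k := by
    rwa [div_pow, div_lt_iff₀ (by positivity)] at hk
  rcases le_total (7 / 3 - ε) 0 with hneg | hpos
  · exact (mul_nonpos_of_nonpos_of_nonneg hneg h0).trans (Nat.cast_nonneg _)
  · have h3 := mul_le_mul_of_nonneg_left h1 hpos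
    linarith
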